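/- Let a, b, c, e ∈ ℂ with Re b > 0, Re c > 0 and Re(a+e-b-c) > 0, and assume that neither e nor a+e-b-c is a nonpositive integer. Then for every real z > 1, ∫_0^1 t^{b-1} (1-t)^{a+e-b-c-1} F(a-c, e-c; a+e-b-c; 1-t) (z-t)^{-a} dt = (Γ(b)Γ(c)Γ(a+e-b-c)/(Γ(a)Γ(e))) · z^{-a} · F(b,c;e;1/z) (a generalized Stieltjes transform sending a ₂F₁ to a ₂F₁). -/

import Mathlib

open MeasureTheory Set Complex Filter

/-- Pochhammer symbol `(a)_k = a (a+1) ⋯ (a+k-1)`. -/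
noncomputable def poch (a : ℂ) (k : ℕ) : ℂ := ∏ i ∈ Finset.range k, (a + i)

/-- The Gauss hypergeometric function `F(a,b;c;x)` for real `x < 1`, defined by the
power series on `[0,1)` and by the (agreeing) Pfaff series for `x < 0`. -/
noncomputable def hypF (a b c : ℂ) (x : ℝ) : ℂ :=
  if 0 ≤ x then
    ∑' k : ℕ, poch a k * poch b k / (poch c k * (Nat.factorial k : ℂ)) * (x : ℂ) ^ k
  else
    ((1 - x : ℝ) : ℂ) ^ (-a) *
      ∑' k : ℕ, poch a k * poch (c - b) k / (poch c k * (Nat.factorial k : ℂ)) *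
        (((x / (x - 1) : ℝ)) : ℂ) ^ k

open scoped Topology

lemma poch_succ (s : ℂ) (n : ℕ) : poch s (n+1) = poch s n * (s + n) := by
  simp [poch, Finset.prod_range_succ]

lemma poch_zero (s : ℂ) : poch s 0 = 1 := by simp [poch]

lemma poch_succ' (s : ℂ) (n : ℕ) : poch s (n+1) = s * poch (s+1) n := by
  unfold poch
  rw [Finset.prod_range_succ', mul_comm]
  congr 1
  · simp
  · refine Finset.prod_congr rfl fun i _ => ?_
    push_cast; ring

lemma poch_one (n : ℕ) : poch 1 n = (n.factorial : ℂ) := by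
  induction n with
  | zero => simp [poch]
  | succ n ih => rw [poch_succ, ih, Nat.factorial_succ]; push_cast; ring

lemma poch_ne_zero {s : ℂ} (hs : ∀ n : ℕ, s ≠ -(n : ℂ)) (n : ℕ) : poch s n ≠ 0 := by
  unfold poch
  rw [Finset.prod_ne_zero_iff]
  intro i _ h
  exact hs i (eq_neg_of_add_eq_zero_left h)

lemma nonpole_of_re_pos {s : ℂ} (hs : 0 < s.re) (n : ℕ) : s ≠ -(n : ℂ) := by
  intro h
  rw [h] at hs
  simp at hs
  have : (0:ℝ) ≤ n := n.cast_nonneg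
  linarith

lemma Gamma_add_nat {s : ℂ} (hs : ∀ n : ℕ, s ≠ -(n : ℂ)) (n : ℕ) :
    Gamma (s + n) = poch s n * Gamma s := by
  induction n with
  | zero => simp [poch]
  | succ n ih =>
    have : s + n ≠ 0 := fun h => hs n (eq_neg_of_add_eq_zero_left h)
    rw [poch_succ, Nat.cast_add, Nat.cast_one, ← add_assoc, Gamma_add_one _ this, ih]
    ring

lemma poch_div_Gamma (s : ℂ) (n : ℕ) :
    poch s n / Gamma (s + n) = 1 / Gamma s := by
  by_cases hs : ∀ n : ℕ, s ≠ -(n : ℂ)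
  · rw [Gamma_add_nat hs]
    have := poch_ne_zero hs n
    have := Gamma_ne_zero hs
    field_simp
  · push Not at hs
    obtain ⟨m, rfl⟩ := hs
    rw [Gamma_neg_nat_eq_zero]
    by_cases hn : n ≤ m
    · have : (-(m:ℂ) + n) = -((m - n : ℕ) : ℂ) := by push_cast [hn]; ring
      rw [this, Gamma_neg_nat_eq_zero]; simp
    · have : poch (-(m:ℂ)) n = 0 := by
        unfold poch
        exact Finset.prod_eq_zero (i := m) (by simp; omega) (by simp)
      rw [this]; simp

/-- normalized Pochhammer -/
noncomputable def npoch (s : ℂ) (n : ℕ) : ℂ := poch s (n+1) / ((n:ℂ)^s * (n.factorial : ℂ))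

lemma npoch_tendsto (s : ℂ) : Tendsto (npoch s) atTop (𝓝 (Gamma s)⁻¹) := by
  have h1 : npoch s = fun n => (GammaSeq s n)⁻¹ := by
    funext n
    rw [npoch, GammaSeq, inv_div]; rfl
  by_cases hs : ∀ n : ℕ, s ≠ -(n : ℂ)
  · rw [h1]
    exact (GammaSeq_tendsto_Gamma s).inv₀ (Gamma_ne_zero hs)
  · push Not at hs
    obtain ⟨m, rfl⟩ := hs
    rw [Gamma_neg_nat_eq_zero, inv_zero]
    apply tendsto_const_nhds.congr'
    filter_upwards [eventually_ge_atTop m] with n hn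
    have : poch (-(m:ℂ)) (n+1) = 0 := by
        unfold poch
        exact Finset.prod_eq_zero (i := m) (by simp; omega) (by simp)
    rw [npoch, this]; simp

lemma poch_eq_npoch (s : ℂ) {n : ℕ} (hn : n ≠ 0) :
    poch s (n+1) = npoch s n * ((n:ℂ)^s * (n.factorial : ℂ)) := by
  have h1 : (n:ℂ)^s ≠ 0 := by simp [cpow_eq_zero_iff, hn]
  have h2 : (n.factorial : ℂ) ≠ 0 := by exact_mod_cast n.factorial_ne_zero
  rw [npoch, div_mul_cancel₀]
  exact mul_ne_zero h1 h2

lemma ratio_eq (α β γ δ : ℂ) {n : ℕ} (hn : n ≠ 0) :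
    poch α (n+1) * poch β (n+1) / (poch γ (n+1) * poch δ (n+1)) =
    (npoch α n * npoch β n * (npoch γ n)⁻¹ * (npoch δ n)⁻¹) * (n:ℂ)^(α+β-γ-δ) := by
  have h0 : (n:ℂ) ≠ 0 := by exact_mod_cast hn
  have h1 : ∀ s : ℂ, (n:ℂ)^s ≠ 0 := by simp [cpow_eq_zero_iff, hn]
  have h2 : (n.factorial : ℂ) ≠ 0 := by exact_mod_cast n.factorial_ne_zero
  rw [poch_eq_npoch _ hn, poch_eq_npoch _ hn, poch_eq_npoch _ hn, poch_eq_npoch _ hn,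
    cpow_sub _ _ h0, cpow_sub _ _ h0, cpow_add _ _ h0]
  have h3 := h1 γ
  have h4 := h1 δ
  field_simp

lemma ratio_tendsto {γ δ : ℂ} (α β : ℂ) (hγ : ∀ n : ℕ, γ ≠ -(n : ℂ))
    (hδ : ∀ n : ℕ, δ ≠ -(n : ℂ)) :
    Tendsto (fun n => npoch α n * npoch β n * (npoch γ n)⁻¹ * (npoch δ n)⁻¹) atTop
      (𝓝 ((Gamma α)⁻¹ * (Gamma β)⁻¹ * Gamma γ * Gamma δ)) := by
  have h1 := (npoch_tendsto γ).inv₀ (inv_ne_zero (Gamma_ne_zero hγ))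
  have h2 := (npoch_tendsto δ).inv₀ (inv_ne_zero (Gamma_ne_zero hδ))
  rw [inv_inv] at h1 h2
  exact (((npoch_tendsto α).mul (npoch_tendsto β)).mul h1).mul h2

lemma ratio_isBigO {γ δ : ℂ} (α β : ℂ) (hγ : ∀ n : ℕ, γ ≠ -(n : ℂ))
    (hδ : ∀ n : ℕ, δ ≠ -(n : ℂ)) :
    (fun n : ℕ => poch α (n+1) * poch β (n+1) / (poch γ (n+1) * poch δ (n+1))) =O[atTop]
      (fun n : ℕ => (n:ℝ)^((α+β-γ-δ).re)) := by
  have h := (ratio_tendsto α β hγ hδ).isBigO_one ℝ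
  have h2 : (fun n : ℕ => (n:ℂ)^(α+β-γ-δ)) =O[atTop]
      (fun n : ℕ => (n:ℝ)^((α+β-γ-δ).re)) := by
    apply Asymptotics.IsBigO.of_bound 1
    filter_upwards [eventually_gt_atTop 0] with n hn
    rw [norm_natCast_cpow_of_pos hn, Real.norm_of_nonneg (by positivity)]; simp
  have h3 := h.mul h2
  simp only [one_mul] at h3
  refine h3.congr' ?_ EventuallyEq.rfl
  filter_upwards [eventually_gt_atTop 0] with n hn
  rw [ratio_eq _ _ _ _ hn.ne']

/-- polynomial growth times geometric is summable -/
lemma summable_poly_geom {f : ℕ → ℂ} {r : ℝ}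
    (hf : (fun n => f (n+1)) =O[atTop] (fun n : ℕ => (n:ℝ)^r)) {x : ℂ} (hx : ‖x‖ < 1) :
    Summable (fun n => ‖f n * x ^ n‖) := by
  rw [← summable_nat_add_iff 1]
  obtain ⟨m, hm⟩ := exists_nat_ge r
  have h1 : (fun n : ℕ => (n:ℝ)^r) =O[atTop] (fun n : ℕ => (n:ℝ)^m) := by
    apply Asymptotics.IsBigO.of_bound 1
    filter_upwards [eventually_ge_atTop 1] with n hn
    rw [Real.norm_of_nonneg (by positivity), Real.norm_of_nonneg (by positivity), one_mul,
      ← Real.rpow_natCast]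
    exact Real.rpow_le_rpow_of_exponent_le (by exact_mod_cast hn) hm
  have h2 : Summable (fun n : ℕ => ‖(n:ℝ)^m * (‖x‖)^n‖) :=
    summable_norm_pow_mul_geometric_of_norm_lt_one m (by simpa using hx)
  have h3 : (fun n => f (n+1) * x^(n+1)) =O[atTop] (fun n : ℕ => ‖(n:ℝ)^m * (‖x‖)^n‖) := by
    refine Asymptotics.IsBigO.norm_right ?_
    refine (hf.trans h1).mul ?_
    apply Asymptotics.IsBigO.of_bound 1
    filter_upwards with n
    rw [norm_pow, norm_pow, norm_norm, one_mul]
    exact pow_le_pow_of_le_one (norm_nonneg _) hx.le (by omega)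
  exact (summable_of_isBigO_nat h2 h3.norm_left)

lemma summable_ratio {α β γ : ℂ} (hγ : ∀ n : ℕ, γ ≠ -(n : ℂ)) (h : 0 < (γ - α - β).re) :
    Summable (fun n => ‖poch α n * poch β n / (poch γ n * (n.factorial : ℂ))‖) := by
  rw [← summable_nat_add_iff 1]
  have h1 := ratio_isBigO α β hγ (δ := 1) (nonpole_of_re_pos (by simp))
  simp only [poch_one] at h1
  refine summable_of_isBigO_nat ?_ h1.norm_left
  rw [Real.summable_nat_rpow]
  simp at h ⊢; linarith

lemma tendsto_nat_mul_ratio {α β γ : ℂ} (hγ : ∀ n : ℕ, γ ≠ -(n : ℂ)) (h : 0 < (γ - α - β).re) :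
    Tendsto (fun n : ℕ => (n:ℂ) * (poch α n * poch β n / (poch γ n * (n.factorial : ℂ))))
      atTop (𝓝 0) := by
  rw [← tendsto_add_atTop_iff_nat 1]
  have h1 := ratio_isBigO α β hγ (δ := 1) (nonpole_of_re_pos (by simp))
  simp only [poch_one] at h1
  have h2 : (fun n : ℕ => ((n+1:ℕ):ℂ)) =O[atTop] (fun n : ℕ => (n:ℝ)) := by
    apply Asymptotics.IsBigO.of_bound 2
    filter_upwards [eventually_ge_atTop 1] with n hn
    rw [Complex.norm_natCast, Real.norm_of_nonneg (by positivity)]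
    have : (1:ℝ) ≤ n := by exact_mod_cast hn
    push_cast; linarith
  refine (h2.mul h1).trans_tendsto ?_
  have h3 : Tendsto (fun n : ℕ => (n:ℝ)^(-(γ-α-β).re)) atTop (𝓝 0) :=
    (tendsto_rpow_neg_atTop h).comp tendsto_natCast_atTop_atTop
  refine h3.congr' ?_
  filter_upwards [eventually_gt_atTop 0] with n hn
  have : (0:ℝ) < n := by exact_mod_cast hn
  rw [← Real.rpow_one_add' this.le]
  · congr 1; simp; ring
  · simp at h ⊢; intro h'; linarith

/-- Gauss series at one -/
noncomputable def gS (α β γ : ℂ) : ℂ :=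
  ∑' n : ℕ, poch α n * poch β n / (poch γ n * (n.factorial : ℂ))

lemma gS_rec {α β γ : ℂ} (hγ : ∀ n : ℕ, γ ≠ -(n : ℂ)) (h : 0 < (γ - α - β).re) :
    γ * (γ - α - β) * gS α β γ = (γ - α) * (γ - β) * gS α β (γ+1) := by
  have hγ1 : ∀ n : ℕ, γ + 1 ≠ -(n : ℂ) := by
    intro n hn
    apply hγ (n+1)
    push_cast
    linear_combination hn
  have h1 : 0 < (γ + 1 - α - β).re := by simp at h ⊢; linarith
  have s0 := (summable_ratio hγ h).of_norm.hasSum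
  have s1 := (summable_ratio hγ1 h1).of_norm.hasSum
  have hs := (s0.mul_left (γ * (γ - α - β))).sub (s1.mul_left ((γ - α) * (γ - β)))
  set D : ℕ → ℂ := fun n => (n:ℂ) * (poch α n * poch β n / (poch γ n * (n.factorial : ℂ))) with hD
  have key : ∀ n : ℕ, γ * (γ - α - β) * (poch α n * poch β n / (poch γ n * (n.factorial : ℂ)))
      - (γ - α) * (γ - β) * (poch α n * poch β n / (poch (γ+1) n * (n.factorial : ℂ)))
      = -γ * (D (n+1) - D n) := by
    intro n
    have e1 : poch γ n * (γ + n) = γ * poch (γ+1) n := by rw [← poch_succ, poch_succ']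
    have n0 : γ ≠ 0 := by simpa using hγ 0
    have n1 : γ + n ≠ 0 := fun h => hγ n (eq_neg_of_add_eq_zero_left h)
    have n2 := poch_ne_zero hγ n
    have n3 := poch_ne_zero hγ1 n
    have n4 : (n.factorial : ℂ) ≠ 0 := by exact_mod_cast n.factorial_ne_zero
    have n5 : (n:ℂ) + 1 ≠ 0 := by exact_mod_cast n.succ_ne_zero
    have e2 : poch (γ+1) n = poch γ n * (γ + n) / γ := by rw [e1]; field_simp
    simp only [hD, poch_succ, Nat.factorial_succ]
    rw [e2]
    push_cast
    field_simp
    ring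
  simp_rw [key] at hs
  have t1 := hs.tendsto_sum_nat
  have t2 : Tendsto (fun n => ∑ i ∈ Finset.range n, -γ * (D (i+1) - D i)) atTop (𝓝 0) := by
    have : ∀ n, ∑ i ∈ Finset.range n, -γ * (D (i+1) - D i) = -γ * D n := by
      intro n
      rw [← Finset.mul_sum, Finset.sum_range_sub]
      simp [hD]
    simp_rw [this]
    simpa using (tendsto_nat_mul_ratio hγ h).const_mul (-γ)
  have := tendsto_nhds_unique t1 t2
  exact sub_eq_zero.mp this

lemma gS_iter {α β γ : ℂ} (hγ : ∀ n : ℕ, γ ≠ -(n : ℂ)) (h : 0 < (γ - α - β).re) (N : ℕ) :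
    gS α β γ = poch (γ-α) N * poch (γ-β) N / (poch γ N * poch (γ-α-β) N) * gS α β (γ + N) := by
  induction N with
  | zero => simp [poch_zero]
  | succ N ih =>
    have hγ1 : ∀ n : ℕ, γ + N ≠ -(n : ℂ) := by
      intro n hn
      apply hγ (n+N)
      push_cast
      linear_combination hn
    have h1 : 0 < (γ + N - α - β).re := by
      have : (0:ℝ) ≤ N := N.cast_nonneg
      simp at h ⊢; linarith
    have hr := gS_rec hγ1 h1
    have n1 : γ + N ≠ 0 := by simpa using hγ1 0
    have n2 : γ - α - β + N ≠ 0 := by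
      intro h'
      have : γ + N - α - β = 0 := by linear_combination h'
      rw [this] at h1; simp at h1
    have e : gS α β (γ + N) = (γ + N - α) * (γ + N - β) / ((γ + N) * (γ - α - β + N)) *
        gS α β (γ + N + 1) := by
      field_simp
      linear_combination hr
    rw [ih, e]
    simp only [poch_succ]
    push_cast
    rw [← add_assoc]
    have n3 := poch_ne_zero hγ N
    have n4 := poch_ne_zero (nonpole_of_re_pos h) N
    field_simp
    ring

lemma norm_add_nat_le {γ : ℂ} (hγ : 0 < γ.re) (N : ℝ) (hN : 0 ≤ N) : ‖γ‖ ≤ ‖γ + N‖ := by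
  rw [Complex.norm_def, Complex.norm_def]
  apply Real.sqrt_le_sqrt
  simp [normSq_apply]
  nlinarith

lemma gS_tendsto {α β γ : ℂ} (hγ : 0 < γ.re) (h : 0 < (γ - α - β).re) :
    Tendsto (fun N : ℕ => gS α β (γ + N)) atTop (𝓝 1) := by
  have hγ' := nonpole_of_re_pos hγ
  have e1 : (1:ℂ) = ∑' n : ℕ, (if n = 0 then (1:ℂ) else 0) := by
    rw [tsum_ite_eq]
  rw [e1]
  unfold gS
  refine tendsto_tsum_of_dominated_convergence (summable_ratio hγ' h) ?_ ?_
  · intro n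
    rcases n with _ | n
    · simp [poch_zero]
    · have : Tendsto (fun N : ℕ => (poch (γ + N) (n+1))⁻¹) atTop (𝓝 0) := by
        unfold poch
        simp_rw [← Finset.prod_inv_distrib]
        have := tendsto_finsetProd (x := atTop) (Finset.range (n+1))
          (f := fun (i N : ℕ) => (γ + N + i)⁻¹) (a := fun _ => 0) ?_
        · simpa using this
        · intro i _
          refine tendsto_inv₀_cobounded.comp (tendsto_norm_atTop_iff_cobounded.1 ?_)
          refine tendsto_atTop_mono (fun N => ?_) (tendsto_natCast_atTop_atTop (R := ℝ))
          refine le_trans ?_ (re_le_norm _)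
          have : (0:ℝ) ≤ i := i.cast_nonneg
          simp; linarith
      have h2 := this.const_mul (poch α (n+1) * poch β (n+1) / ((n+1).factorial : ℂ))
      simp only [mul_zero] at h2
      simp only [Nat.succ_ne_zero, if_false]
      refine h2.congr fun N => ?_
      rw [← div_eq_mul_inv, div_div, mul_comm (poch (γ + N) (n+1))]
  · filter_upwards with N n
    rw [norm_div, norm_div, norm_mul (poch γ n), norm_mul (poch (γ + N) n)]
    have hp : 0 < ‖poch γ n‖ := norm_pos_iff.mpr (poch_ne_zero hγ' n)
    have hle : ‖poch γ n‖ ≤ ‖poch (γ + N) n‖ := by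
      unfold poch
      rw [norm_prod, norm_prod]
      refine Finset.prod_le_prod (fun _ _ => norm_nonneg _) fun i _ => ?_
      have hi : (0:ℝ) ≤ i := i.cast_nonneg
      have := norm_add_nat_le (γ := γ + i) (by simp; linarith) N N.cast_nonneg
      rw [show γ + N + i = γ + i + ((N:ℝ):ℂ) by push_cast; ring]
      exact this
    have hf : 0 < ‖(n.factorial : ℂ)‖ := by
      rw [norm_pos_iff]; exact_mod_cast n.factorial_ne_zero
    gcongr

/-- Gauss's summation theorem. -/
lemma gauss_sum {α β γ : ℂ} (hγ : 0 < γ.re) (h : 0 < (γ - α - β).re) :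
    gS α β γ = Gamma γ * Gamma (γ - α - β) / (Gamma (γ - α) * Gamma (γ - β)) := by
  have hγ' := nonpole_of_re_pos hγ
  have h' := nonpole_of_re_pos h
  have t1 := ratio_tendsto (γ - α) (γ - β) hγ' h'
  have t2 := (tendsto_add_atTop_iff_nat 1).2 (gS_tendsto hγ h)
  have t3 := t1.mul t2
  have t4 : Tendsto (fun _ : ℕ => gS α β γ) atTop (𝓝 (gS α β γ)) := tendsto_const_nhds
  have := tendsto_nhds_unique t4 (t3.congr' ?_)
  · rw [this, mul_one, div_eq_mul_inv, mul_inv]; ring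
  · filter_upwards [eventually_gt_atTop 0] with n hn
    rw [gS_iter hγ' h (n+1), ratio_eq _ _ _ _ hn.ne']
    rw [show γ - α + (γ - β) - γ - (γ - α - β) = 0 by ring, cpow_zero, mul_one]

lemma beta_integrable {u v : ℂ} (hu : 0 < u.re) (hv : 0 < v.re) :
    IntegrableOn (fun t : ℝ => (t:ℂ)^(u-1) * ((1-t:ℝ):ℂ)^(v-1)) (Ioo 0 1) := by
  have := betaIntegral_convergent hu hv
  rw [intervalIntegrable_iff_integrableOn_Ioo_of_le zero_le_one] at this
  simpa using this

lemma beta_integral {u v : ℂ} (hu : 0 < u.re) (hv : 0 < v.re) :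
    ∫ t in Ioo (0:ℝ) 1, (t:ℂ)^(u-1) * ((1-t:ℝ):ℂ)^(v-1) =
      Gamma u * Gamma v / Gamma (u + v) := by
  have h := Gamma_mul_Gamma_eq_betaIntegral hu hv
  have h0 : Gamma (u+v) ≠ 0 := Gamma_ne_zero_of_re_pos (by simp; linarith)
  rw [h, mul_div_cancel_left₀ _ h0, betaIntegral, intervalIntegral.integral_of_le zero_le_one,
    integral_Ioc_eq_integral_Ioo]
  simp

lemma beta_norm_integral {u v : ℂ} (hu : 0 < u.re) (hv : 0 < v.re) :
    ((∫ t in Ioo (0:ℝ) 1, ‖(t:ℂ)^(u-1) * ((1-t:ℝ):ℂ)^(v-1)‖ : ℝ) : ℂ) =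
      Gamma (u.re : ℂ) * Gamma (v.re : ℂ) / Gamma (u.re + v.re : ℂ) := by
  rw [← beta_integral (u := (u.re : ℂ)) (v := (v.re : ℂ)) (by simpa) (by simpa),
    ← integral_complex_ofReal]
  refine setIntegral_congr_fun measurableSet_Ioo fun t ht => ?_
  have h1 : 0 < 1 - t := sub_pos.mpr ht.2
  rw [norm_mul, norm_cpow_eq_rpow_re_of_pos ht.1, norm_cpow_eq_rpow_re_of_pos h1]
  rw [ofReal_mul, ofReal_cpow ht.1.le, ofReal_cpow h1.le]
  simp

lemma binom_hasSum (a : ℂ) {x : ℂ} (hx : ‖x‖ < 1) :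
    HasSum (fun k : ℕ => poch a k / (k.factorial : ℂ) * x ^ k) ((1 - x) ^ (-a)) := by
  have h := (one_div_one_sub_cpow_hasFPowerSeriesOnBall_zero a).hasSum (y := x)
    (by simpa [enorm_eq_nnnorm] using! hx)
  simp only [zero_add, one_div, ← cpow_neg] at h
  convert! h using 1
  funext k
  have e : Ring.choose (a + k - 1) k = poch a k / (k.factorial : ℂ) := by
    rw [Ring.choose_eq_smul, Polynomial.descPochhammer_smeval_eq_ascPochhammer,
      Polynomial.ascPochhammer_smeval_cast, Polynomial.ascPochhammer_smeval_eq_eval,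
      show a + k - 1 - k + 1 = a by ring, smul_eq_mul, div_eq_inv_mul]
    congr 1
    rw [poch]
    clear h hx
    induction k with
    | zero => simp
    | succ k ih => rw [Finset.prod_range_succ, ascPochhammer_succ_eval, ih]
  simp [FormalMultilinearSeries.ofScalars, e]

lemma binom_summable (a : ℂ) {x : ℂ} (hx : ‖x‖ < 1) :
    Summable (fun k : ℕ => ‖poch a k / (k.factorial : ℂ) * x ^ k‖) := by
  have h1 : ∀ n : ℕ, (1:ℂ) ≠ -(n : ℂ) := nonpole_of_re_pos (by simp)
  have h := ratio_isBigO a 1 h1 h1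
  refine summable_poly_geom (r := (a+1-1-1).re) (h.congr_left fun n => ?_) hx
  have : poch 1 (n+1) ≠ 0 := poch_ne_zero h1 _
  rw [← poch_one]
  field_simp

/-- the coefficient sequence weighted by Beta function values is summable -/
lemma coef_beta_summable {α β g b : ℂ} (hb : 0 < b.re) (hg : 0 < g.re)
    (h : 0 < (g + b - α - β).re) :
    Summable (fun n : ℕ => ‖poch α n * poch β n / (poch g n * (n.factorial : ℂ))‖ *
      ∫ t in Ioo (0:ℝ) 1, ‖(t:ℂ)^(b-1) * ((1-t:ℝ):ℂ)^(g + n - 1)‖) := by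
  have hG : ∀ n : ℕ, g ≠ -(n : ℂ) := nonpole_of_re_pos hg
  have h1 : ∀ n : ℕ, (1:ℂ) ≠ -(n : ℂ) := nonpole_of_re_pos (by simp)
  have hGr : ∀ n : ℕ, (g.re:ℂ) ≠ -(n : ℂ) := nonpole_of_re_pos (by simpa)
  have hGb : ∀ n : ℕ, (b.re + g.re:ℂ) ≠ -(n : ℂ) := nonpole_of_re_pos (by simp; linarith)
  have b1 := ratio_isBigO α β hG h1
  have b2 := ratio_isBigO (g.re:ℂ) 1 hGb h1
  have b3 := (b1.mul b2).const_mul_left (Gamma b.re * Gamma g.re / Gamma (b.re + g.re))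
  have key : ∀ n : ℕ, ((∫ t in Ioo (0:ℝ) 1, ‖(t:ℂ)^(b-1) * ((1-t:ℝ):ℂ)^(g + n - 1)‖ : ℝ) : ℂ) =
      Gamma b.re * Gamma g.re / Gamma (b.re + g.re) * (poch g.re n * poch 1 n /
        (poch (b.re + g.re) n * poch 1 n)) := by
    intro n
    have hn : (0:ℝ) ≤ n := n.cast_nonneg
    rw [beta_norm_integral hb (v := g + n) (by simp; linarith)]
    simp only [add_re, natCast_re, ofReal_add, ofReal_natCast]
    rw [← add_assoc, Gamma_add_nat hGr, Gamma_add_nat hGb]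
    have n1 := poch_ne_zero hGb n
    have n2 := poch_ne_zero h1 n
    have n3 := Gamma_ne_zero hGb
    field_simp
  rw [← summable_nat_add_iff 1]
  have hs : Summable (fun n : ℕ => (n:ℝ)^(α+β-g-1).re * (n:ℝ)^((g.re:ℂ)+1-(b.re + g.re)-1).re) := by
    rw [← summable_nat_add_iff 1]
    have : Summable (fun n : ℕ => (n:ℝ)^((α+β-g-1).re + ((g.re:ℂ)+1-(b.re + g.re)-1).re)) := by
      rw [Real.summable_nat_rpow]
      simp at h ⊢; linarith
    rw [← summable_nat_add_iff 1] at this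
    refine this.congr fun n => ?_
    rw [Real.rpow_add (by positivity)]
  refine summable_of_isBigO_nat hs ?_
  refine (b3.norm_left).congr_left fun n => ?_
  rw [← Real.norm_of_nonneg (integral_nonneg (fun t => norm_nonneg _)), ← norm_real, key, ← norm_mul,
    poch_one]
  congr 1
  ring

lemma coef_summable {α β g x : ℂ} (hg : ∀ n : ℕ, g ≠ -(n : ℂ)) (hx : ‖x‖ < 1) :
    Summable (fun n : ℕ => ‖poch α n * poch β n / (poch g n * (n.factorial : ℂ)) * x ^ n‖) := by
  have h1 : ∀ n : ℕ, (1:ℂ) ≠ -(n : ℂ) := nonpole_of_re_pos (by simp)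
  have h := ratio_isBigO α β hg h1
  refine summable_poly_geom (r := (α+β-g-1).re) (h.congr_left fun n => ?_) hx
  rw [poch_one]

/-- moments -/
lemma moment_hasSum {a b c e g : ℂ} (hgdef : g = a + e - b - c) (hb : 0 < b.re) (hc : 0 < c.re)
    (hg : 0 < g.re) :
    ∑' n : ℕ, poch (a-c) n * poch (e-c) n / (poch g n * (n.factorial : ℂ)) *
      (Gamma b * Gamma (g + n) / Gamma (b + (g + n)))
      = Gamma b * Gamma c * Gamma g / (Gamma a * Gamma e) := by
  have hG : ∀ n : ℕ, g ≠ -(n : ℂ) := nonpole_of_re_pos hg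
  have hbg : 0 < (b + g).re := by simp; linarith
  have hBG : ∀ n : ℕ, b + g ≠ -(n : ℂ) := nonpole_of_re_pos hbg
  have h := gauss_sum (α := a - c) (β := e - c) hbg
    (by rw [show b + g - (a - c) - (e - c) = c by rw [hgdef]; ring]; exact hc)
  rw [show b + g - (a - c) - (e - c) = c by rw [hgdef]; ring,
    show b + g - (a - c) = e by rw [hgdef]; ring,
    show b + g - (e - c) = a by rw [hgdef]; ring] at h
  have e1 : ∀ n : ℕ, poch (a-c) n * poch (e-c) n / (poch g n * (n.factorial : ℂ)) *
      (Gamma b * Gamma (g + n) / Gamma (b + (g + n))) = Gamma b * Gamma g / Gamma (b + g) *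
        (poch (a-c) n * poch (e-c) n / (poch (b+g) n * (n.factorial : ℂ))) := by
    intro n
    rw [← add_assoc, Gamma_add_nat hG, Gamma_add_nat hBG]
    have n1 := poch_ne_zero hG n
    have n2 := poch_ne_zero hBG n
    have n3 := Gamma_ne_zero hBG
    have n4 : (n.factorial : ℂ) ≠ 0 := by exact_mod_cast n.factorial_ne_zero
    field_simp
  simp_rw [e1]
  rw [tsum_mul_left, ← gS, h]
  have n3 := Gamma_ne_zero hBG
  rw [mul_comm (Gamma e)]
  field_simp

/-- A generalized Stieltjes transform sending a `₂F₁` to a `₂F₁` (case `d = a` of the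
Karp–Sitnik formula). -/
theorem stmt_12 (a b c e : ℂ) (hb : 0 < b.re) (hc : 0 < c.re)
    (hae : 0 < (a + e - b - c).re)
    (he : ∀ n : ℕ, e ≠ -(n : ℂ))
    (haebc : ∀ n : ℕ, a + e - b - c ≠ -(n : ℂ))
    (z : ℝ) (hz : 1 < z) :
    ∫ t in Ioo (0:ℝ) 1,
        (t : ℂ) ^ (b - 1) * ((1 - t : ℝ) : ℂ) ^ (a + e - b - c - 1) *
          hypF (a - c) (e - c) (a + e - b - c) (1 - t) * ((z - t : ℝ) : ℂ) ^ (-a)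
      = Complex.Gamma b * Complex.Gamma c * Complex.Gamma (a + e - b - c) /
          (Complex.Gamma a * Complex.Gamma e) *
        (z : ℂ) ^ (-a) * hypF b c e (1 / z) := by
  set g := a + e - b - c with hgdef
  set α := a - c with hα
  set β := e - c with hβ
  set C : ℕ → ℂ := fun n => poch α n * poch β n / (poch g n * (n.factorial : ℂ)) with hC
  set A : ℕ → ℂ := fun k => poch a k / (k.factorial : ℂ) * ((1/z : ℝ) : ℂ) ^ k with hA
  have hz0 : 0 < z := by linarith
  have hzi : ‖((1/z : ℝ) : ℂ)‖ < 1 := by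
    rw [norm_real, Real.norm_of_nonneg (by positivity), div_lt_one hz0]; exact hz
  have hAs : Summable (fun k => ‖A k‖) := binom_summable a hzi
  let F : ℕ × ℕ → ℝ → ℂ := fun p t =>
    A p.1 * C p.2 * ((t:ℂ)^(b + p.1 - 1) * ((1-t:ℝ):ℂ)^(g + p.2 - 1))
  have hre : ∀ (s : ℂ) (n : ℕ), 0 < s.re → 0 < (s + n).re := by
    intro s n hs
    have : (0:ℝ) ≤ n := n.cast_nonneg
    simp; linarith
  have hFint : ∀ p, Integrable (F p) (volume.restrict (Ioo 0 1)) := fun p =>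
    (beta_integrable (hre b p.1 hb) (hre g p.2 hae)).const_mul _
  have hFval : ∀ p, ∫ t in Ioo (0:ℝ) 1, F p t = A p.1 * (C p.2 *
      (Gamma (b + p.1) * Gamma (g + p.2) / Gamma (b + p.1 + (g + p.2)))) := by
    intro p
    simp only [F]
    rw [integral_const_mul, beta_integral (hre b p.1 hb) (hre g p.2 hae), mul_assoc]
  have hCs : Summable (fun n : ℕ => ‖C n‖ *
      ∫ t in Ioo (0:ℝ) 1, ‖(t:ℂ)^(b-1) * ((1-t:ℝ):ℂ)^(g + n - 1)‖) := by
    refine coef_beta_summable hb hae ?_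
    rw [show g + b - α - β = c by rw [hgdef, hα, hβ]; ring]; exact hc
  have hFsum : Summable (fun p => ∫ t in Ioo (0:ℝ) 1, ‖F p t‖) := by
    refine Summable.of_nonneg_of_le (fun p => integral_nonneg fun t => norm_nonneg _) (fun p => ?_)
      (hAs.mul_of_nonneg hCs (fun _ => norm_nonneg _)
        (fun n => mul_nonneg (norm_nonneg _) (integral_nonneg fun t => norm_nonneg _)))
    rw [← mul_assoc, ← integral_const_mul]
    refine setIntegral_mono_on (hFint p).norm
      ((beta_integrable hb (hre g p.2 hae)).norm.const_mul _) measurableSet_Ioo fun t ht => ?_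
    simp only [F]
    rw [norm_mul, norm_mul (A p.1)]
    gcongr ‖A p.1‖ * ‖C p.2‖ * ?_
    rw [norm_mul, norm_mul]
    gcongr ?_ * _
    rw [norm_cpow_eq_rpow_re_of_pos ht.1, norm_cpow_eq_rpow_re_of_pos ht.1]
    apply Real.rpow_le_rpow_of_exponent_ge ht.1 ht.2.le
    have : (0:ℝ) ≤ p.1 := p.1.cast_nonneg
    simp
  have hmain := hasSum_integral_of_summable_integral_norm hFint hFsum
  have hmain' := hmain.mul_left ((z:ℂ)^(-a))
  rw [← integral_const_mul] at hmain'
  have hL : ∫ t in Ioo (0:ℝ) 1,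
        (t : ℂ) ^ (b - 1) * ((1 - t : ℝ) : ℂ) ^ (g - 1) *
          hypF α β g (1 - t) * ((z - t : ℝ) : ℂ) ^ (-a)
      = ∫ t in Ioo (0:ℝ) 1, (z:ℂ)^(-a) * ∑' p, F p t := by
    refine setIntegral_congr_fun measurableSet_Ioo fun t ht => ?_
    have h1 : 0 < 1 - t := sub_pos.mpr ht.2
    have ht0 : (t:ℂ) ≠ 0 := by exact_mod_cast ht.1.ne'
    have h10 : ((1-t:ℝ):ℂ) ≠ 0 := by exact_mod_cast h1.ne'
    have htz : t / z < 1 := by rw [div_lt_one hz0]; linarith [ht.2]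
    have hx1 : ‖((t/z:ℝ):ℂ)‖ < 1 := by
      rw [norm_real, Real.norm_of_nonneg (div_nonneg ht.1.le hz0.le)]; exact htz
    have hx2 : ‖((1-t:ℝ):ℂ)‖ < 1 := by
      rw [norm_real, Real.norm_of_nonneg h1.le]; linarith [ht.1]
    have s1 := binom_summable a hx1
    have s2 := coef_summable (α := α) (β := β) haebc hx2
    have hm := tsum_mul_tsum_of_summable_norm s1 s2
    rw [(binom_hasSum a hx1).tsum_eq] at hm
    have hF : ∀ p : ℕ × ℕ, F p t = (t : ℂ) ^ (b - 1) * ((1 - t : ℝ) : ℂ) ^ (g - 1) *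
        (poch a p.1 / (p.1.factorial : ℂ) * ((t/z:ℝ):ℂ) ^ p.1 *
        (poch α p.2 * poch β p.2 / (poch g p.2 * (p.2.factorial : ℂ)) * ((1-t:ℝ):ℂ) ^ p.2)) := by
      intro p
      simp only [F, hA, hC]
      rw [show b + p.1 - 1 = b - 1 + p.1 by ring, show g + p.2 - 1 = g - 1 + p.2 by ring,
        cpow_add _ _ ht0, cpow_add _ _ h10, cpow_natCast, cpow_natCast,
        show t / z = t * (1/z) by ring, ofReal_mul t, mul_pow]
      ring
    simp only [hF]
    rw [tsum_mul_left, ← hm]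
    have hzt : ((z - t : ℝ) : ℂ) ^ (-a) = (z:ℂ)^(-a) * (1 - ((t/z:ℝ):ℂ))^(-a) := by
      rw [show z - t = z * (1 - t/z) by field_simp, ofReal_mul,
        mul_cpow_ofReal_nonneg hz0.le (by linarith)]
      push_cast; rfl
    rw [hzt, hypF, if_pos h1.le]
    ring
  rw [hL, ← hmain'.tsum_eq]
  have hsm := hmain'.summable
  rw [hsm.tsum_prod]
  rw [hypF, if_pos (by positivity), ← tsum_mul_left]
  refine tsum_congr fun k => ?_
  simp only [hFval]
  rw [tsum_mul_left, tsum_mul_left]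
  have hmom := moment_hasSum (a := a + k) (b := b + k) (c := c + k) (e := e + k) (g := g)
    (by rw [hgdef]; ring) (hre b k hb) (hre c k hc) hae
  rw [show a + k - (c + k) = α by rw [hα]; ring, show e + k - (c + k) = β by rw [hβ]; ring] at hmom
  rw [hmom, Gamma_add_nat (nonpole_of_re_pos hb), Gamma_add_nat (nonpole_of_re_pos hc),
    Gamma_add_nat he]
  have hp := poch_div_Gamma a k
  simp only [hA]
  calc _ = (z:ℂ)^(-a) * ((1/z:ℝ):ℂ)^k * (poch a k / Gamma (a + k)) * (poch b k * Gamma b *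
        (poch c k * Gamma c) * Gamma g / (k.factorial * (poch e k * Gamma e))) := by
        simp only [div_eq_mul_inv, mul_inv]; ring
    _ = _ := by rw [hp]; simp only [div_eq_mul_inv, mul_inv]; ring
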